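/- arXiv:1402.0069 — 2 statements merged into one kernel-verified Lean document; each statement's English description precedes it below -/
import Mathlib

section
/- Let m be a positive integer, τ ∈ ℝ with τ ≠ 0 and τ ≠ 1, let P and Q be m×m Hermitian positive definite complex matrices, and let L be any invertible m×m matrix with L·L* = Q. Define D_T^{(τ)}(P‖Q) := tr[(1/(τ(τ−1)))(L⁻¹ P L⁻*)^τ − (1/(τ−1)) P Q⁻¹] + m/τ, where the matrix power is taken via the spectral calculus of the Hermitian positive definite matrix L⁻¹ P L⁻*. Then D_T^{(τ)}(P‖Q) ≥ 0, and D_T^{(τ)}(P‖Q) = 0 if and only if P = Q. -/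
open Matrix
open scoped Classical ComplexOrder

/-- Real power of a matrix via the spectral calculus (junk value `0` if not Hermitian). -/
noncomputable def mPow {n : ℕ} (A : Matrix (Fin n) (Fin n) ℂ) (τ : ℝ) :
    Matrix (Fin n) (Fin n) ℂ :=
  if hA : A.IsHermitian then
    (hA.eigenvectorUnitary : Matrix (Fin n) (Fin n) ℂ) *
      Matrix.diagonal (fun i => ((hA.eigenvalues i ^ τ : ℝ) : ℂ)) *
      (star hA.eigenvectorUnitary : Matrix (Fin n) (Fin n) ℂ)
  else 0

/-- The matrix divergence `D_T^{(τ)}(P‖Q)` computed with the factor `L` of `Q = L·L*`: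
`tr[(1/(τ(τ−1)))(L⁻¹ P L⁻*)^τ − (1/(τ−1)) P Q⁻¹] + m/τ`. -/
noncomputable def Dtau {m : ℕ} (τ : ℝ) (P Q L : Matrix (Fin m) (Fin m) ℂ) : ℝ :=
  (Matrix.trace ((1 / (τ * (τ - 1)) : ℝ) • mPow (L⁻¹ * P * (Lᴴ)⁻¹) τ -
      (1 / (τ - 1) : ℝ) • (P * Q⁻¹))).re + m / τ

/-- Strict Bernoulli inequality, normalised so that the sign is the same for all exponents. -/
lemma bernoulli_gap_pos {τ x : ℝ} (hτ0 : τ ≠ 0) (hτ1 : τ ≠ 1) (hx : 0 < x) (hx1 : x ≠ 1) :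
    0 < 1 / (τ * (τ - 1)) * x ^ τ - 1 / (τ - 1) * x + 1 / τ := by
  have hτ1' : τ - 1 ≠ 0 := sub_ne_zero.mpr hτ1
  have key : 1 / (τ * (τ - 1)) * x ^ τ - 1 / (τ - 1) * x + 1 / τ =
      (x ^ τ - (1 + τ * (x - 1))) / (τ * (τ - 1)) := by
    field_simp
    ring
  rw [key]
  have hs : -1 ≤ x - 1 := by linarith
  have hs' : x - 1 ≠ 0 := sub_ne_zero.mpr hx1
  rcases lt_or_gt_of_ne hτ1 with h1 | h1
  · rcases lt_or_gt_of_ne hτ0 with h0 | h0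
    · have hy : -1 ≤ x⁻¹ - 1 := by linarith [inv_pos.mpr hx]
      have hy' : x⁻¹ - 1 ≠ 0 := sub_ne_zero.mpr (by simpa using hx1)
      have h := one_add_mul_self_lt_rpow_one_add hy hy' (p := 1 - τ) (by linarith)
      rw [add_sub_cancel, Real.inv_rpow hx.le, ← Real.rpow_neg hx.le, neg_sub,
        Real.rpow_sub_one hx.ne', lt_div_iff₀ hx] at h
      have e : (1 + (1 - τ) * (x⁻¹ - 1)) * x = 1 + τ * (x - 1) := by
        field_simp
        ring
      rw [e] at h
      exact div_pos (by linarith) (mul_pos_of_neg_of_neg h0 (by linarith))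
    · have h := rpow_one_add_lt_one_add_mul_self hs hs' h0 h1
      rw [add_sub_cancel] at h
      exact div_pos_of_neg_of_neg (by linarith) (mul_neg_of_pos_of_neg h0 (by linarith))
  · have h := one_add_mul_self_lt_rpow_one_add hs hs' h1
    rw [add_sub_cancel] at h
    exact div_pos (by linarith) (mul_pos (by linarith) (by linarith))

lemma bernoulli_gap_one {τ : ℝ} (hτ0 : τ ≠ 0) (hτ1 : τ ≠ 1) :
    1 / (τ * (τ - 1)) * (1 : ℝ) ^ τ - 1 / (τ - 1) * 1 + 1 / τ = 0 := by
  have hτ1' : τ - 1 ≠ 0 := sub_ne_zero.mpr hτ1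
  rw [Real.one_rpow]
  field_simp
  ring

lemma trace_mPow {n : ℕ} {A : Matrix (Fin n) (Fin n) ℂ} (hA : A.IsHermitian) (τ : ℝ) :
    (mPow A τ).trace = ((∑ i, hA.eigenvalues i ^ τ : ℝ) : ℂ) := by
  rw [mPow, dif_pos hA, Matrix.trace_mul_comm, ← mul_assoc,
    Unitary.coe_star_mul_self, one_mul, Matrix.trace_diagonal, Complex.ofReal_sum]

lemma Matrix.IsHermitian.eigenvalues_eq_one_iff {n : ℕ} {A : Matrix (Fin n) (Fin n) ℂ}
    (hA : A.IsHermitian) : (∀ i, hA.eigenvalues i = 1) ↔ A = 1 := by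
  constructor
  · intro h
    have h1 : (RCLike.ofReal ∘ hA.eigenvalues : Fin n → ℂ) = fun _ => 1 := by
      ext i
      simp [h i]
    rw [hA.spectral_theorem, h1, Matrix.diagonal_one, map_one]
  · rintro rfl i
    have : Nonempty (Fin n) := ⟨i⟩
    simpa [spectrum.one_eq] using hA.eigenvalues_mem_spectrum_real i

lemma trace_mul_inv_of_factor {m : ℕ} (P L : Matrix (Fin m) (Fin m) ℂ) :
    (P * (L * Lᴴ)⁻¹).trace = (L⁻¹ * P * (Lᴴ)⁻¹).trace := by
  rw [Matrix.mul_inv_rev, ← mul_assoc, Matrix.trace_mul_comm, mul_assoc]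

lemma whitened_eq_one_iff {m : ℕ} {P L : Matrix (Fin m) (Fin m) ℂ} (hL : IsUnit L.det) :
    L⁻¹ * P * (Lᴴ)⁻¹ = 1 ↔ P = L * Lᴴ := by
  have hL' : IsUnit (Lᴴ).det := by
    rw [Matrix.det_conjTranspose]
    exact hL.star
  constructor
  · intro h
    calc P = L * (L⁻¹ * P * (Lᴴ)⁻¹) * Lᴴ := by
          rw [mul_assoc, Matrix.nonsing_inv_mul_cancel_right _ _ hL',
            Matrix.mul_nonsing_inv_cancel_left _ _ hL]
      _ = L * Lᴴ := by rw [h, mul_one]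
  · rintro rfl
    rw [Matrix.nonsing_inv_mul_cancel_left _ _ hL, Matrix.mul_nonsing_inv _ hL']

lemma whitened_posDef {m : ℕ} {P L : Matrix (Fin m) (Fin m) ℂ} (hP : P.PosDef)
    (hL : IsUnit L.det) : (L⁻¹ * P * (Lᴴ)⁻¹).PosDef := by
  rw [← Matrix.conjTranspose_nonsing_inv]
  refine hP.mul_mul_conjTranspose_same (Matrix.vecMul_injective_of_isUnit ?_)
  exact (Matrix.isUnit_nonsing_inv_iff).mpr ((Matrix.isUnit_iff_isUnit_det L).mpr hL)

lemma Dtau_eq_sum {m : ℕ} (τ : ℝ) {P L : Matrix (Fin m) (Fin m) ℂ}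
    (hA : (L⁻¹ * P * (Lᴴ)⁻¹).IsHermitian) :
    Dtau τ P (L * Lᴴ) L = ∑ i, (1 / (τ * (τ - 1)) * hA.eigenvalues i ^ τ -
      1 / (τ - 1) * hA.eigenvalues i + 1 / τ) := by
  have h2 : (P * (L * Lᴴ)⁻¹).trace = ((∑ i, hA.eigenvalues i : ℝ) : ℂ) := by
    rw [trace_mul_inv_of_factor, hA.trace_eq_sum_eigenvalues, Complex.ofReal_sum]
    rfl
  rw [Dtau, Matrix.trace_sub, Matrix.trace_smul, Matrix.trace_smul, trace_mPow hA, h2,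
    Complex.sub_re, Complex.smul_re, Complex.smul_re, Complex.ofReal_re, Complex.ofReal_re,
    Finset.sum_add_distrib, Finset.sum_sub_distrib, ← Finset.mul_sum, ← Finset.mul_sum]
  simp [div_eq_mul_inv]

/-- For `τ ∈ ℝ \ {0,1}` and Hermitian positive definite `P, Q`, and any
invertible `L` with `L·L* = Q`, one has `D_T^{(τ)}(P‖Q) ≥ 0` with equality iff `P = Q`. -/
theorem Dtau_nonneg_eq_zero_iff {m : ℕ} (hm : 0 < m) (τ : ℝ) (hτ0 : τ ≠ 0) (hτ1 : τ ≠ 1)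
    (P Q L : Matrix (Fin m) (Fin m) ℂ) (hP : P.PosDef) (hQ : Q.PosDef)
    (hL : IsUnit L.det) (hLQ : L * Lᴴ = Q) :
    0 ≤ Dtau τ P Q L ∧ (Dtau τ P Q L = 0 ↔ P = Q) := by
  subst hLQ
  have hA := whitened_posDef hP hL
  have hgap : ∀ i, 0 ≤ 1 / (τ * (τ - 1)) * hA.1.eigenvalues i ^ τ -
      1 / (τ - 1) * hA.1.eigenvalues i + 1 / τ := fun i => by
    by_cases h : hA.1.eigenvalues i = 1
    · rw [h, bernoulli_gap_one hτ0 hτ1]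
    · exact (bernoulli_gap_pos hτ0 hτ1 (hA.eigenvalues_pos i) h).le
  rw [Dtau_eq_sum τ hA.1]
  refine ⟨Finset.sum_nonneg fun i _ => hgap i, ?_⟩
  rw [Finset.sum_eq_zero_iff_of_nonneg fun i _ => hgap i, ← whitened_eq_one_iff hL,
    ← hA.1.eigenvalues_eq_one_iff]
  refine ⟨fun h i => ?_, fun h i _ => ?_⟩
  · by_contra h1
    exact (bernoulli_gap_pos hτ0 hτ1 (hA.eigenvalues_pos i) h1).ne' (h i (Finset.mem_univ i))
  · rw [h i, bernoulli_gap_one hτ0 hτ1]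
end

section
/- Let n > m be positive integers, let A be an n×n real matrix with spectral radius strictly less than 1, let B be an n×m real matrix of full column rank such that the pair (A,B) is reachable (i.e. the matrix [B, AB, …, A^{n−1}B] has rank n), and set Π_B^⊥ := I − B(BᵀB)⁻¹Bᵀ and V(Q) := Π_B^⊥(Q − AQAᵀ)Π_B^⊥ for n×n real symmetric Q. Let Σ_C be an n×n real symmetric positive definite matrix, let ν ≥ 2 be an integer, and set τ := 1 − ν⁻¹. For real symmetric positive definite Σ define D_T^{(τ)}(Σ‖Σ_C) := tr[(1/(τ(τ−1)))(L⁻¹ Σ L⁻ᵀ)^τ − (1/(τ−1)) Σ Σ_C⁻¹] + n/τ, where L is the Cholesky factor of Σ_C (Σ_C = L Lᵀ). Then the minimization of D_T^{(τ)}(Σ‖Σ_C) over the set {Σ real symmetric positive definite : V(Σ) = 0} admits exactly one solution. -/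
open Matrix
open scoped Classical

/-- Real power of a real symmetric matrix via the spectral calculus
(junk value `0` if not symmetric). -/
noncomputable def mPowR {n : ℕ} (A : Matrix (Fin n) (Fin n) ℝ) (τ : ℝ) :
    Matrix (Fin n) (Fin n) ℝ :=
  if hA : A.IsHermitian then
    (hA.eigenvectorUnitary : Matrix (Fin n) (Fin n) ℝ) *
      Matrix.diagonal (fun i => (hA.eigenvalues i ^ τ : ℝ)) *
      (star hA.eigenvectorUnitary : Matrix (Fin n) (Fin n) ℝ)
  else 0

/-- The matrix divergence `D_T^{(τ)}(Σ‖Σ_C)` computed with the factor `L` of `Σ_C = L·Lᵀ`: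
`tr[(1/(τ(τ−1)))(L⁻¹ Σ L⁻ᵀ)^τ − (1/(τ−1)) Σ Σ_C⁻¹] + n/τ`. -/
noncomputable def DtauR {n : ℕ} (τ : ℝ) (Sg SgC L : Matrix (Fin n) (Fin n) ℝ) : ℝ :=
  Matrix.trace ((1 / (τ * (τ - 1))) • mPowR (L⁻¹ * Sg * (Lᵀ)⁻¹) τ -
    (1 / (τ - 1)) • (Sg * SgC⁻¹)) + n / τ

theorem Real.rpow_le_tangent {τ : ℝ} (hτ0 : 0 < τ) (hτ1 : τ < 1) {a b : ℝ} (ha : 0 ≤ a)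
    (hb : 0 < b) : a ^ τ ≤ b ^ τ + τ * b ^ (τ - 1) * (a - b) := by
  have h := _root_.rpow_one_add_le_one_add_mul_self (s := a / b - 1)
    (by linarith [div_nonneg ha hb.le]) hτ0.le hτ1.le
  rw [add_sub_cancel, Real.div_rpow ha hb.le, div_le_iff₀ (by positivity)] at h
  rw [Real.rpow_sub_one hb.ne']
  calc a ^ τ ≤ _ := h
    _ = _ := by field_simp

theorem Real.eq_of_rpow_eq_tangent {τ : ℝ} (hτ0 : 0 < τ) (hτ1 : τ < 1) {a b : ℝ} (ha : 0 ≤ a)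
    (hb : 0 < b) (hab : a ^ τ = b ^ τ + τ * b ^ (τ - 1) * (a - b)) : a = b := by
  by_contra hne
  have h := _root_.rpow_one_add_lt_one_add_mul_self (s := a / b - 1)
    (by linarith [div_nonneg ha hb.le])
    (by rw [sub_ne_zero]; exact fun h => hne ((div_eq_one_iff_eq hb.ne').1 h)) hτ0 hτ1
  rw [add_sub_cancel, Real.div_rpow ha hb.le, div_lt_iff₀ (by positivity)] at h
  rw [Real.rpow_sub_one hb.ne'] at hab
  refine h.ne (hab.trans ?_)
  field_simp

namespace Matrix

variable {ι : Type*} [Fintype ι] [DecidableEq ι]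

theorem trace_diagonal_conj_mul_diagonal_conj (U V : Matrix ι ι ℝ) (p q : ι → ℝ) :
    trace (V * diagonal p * Vᵀ * (U * diagonal q * Uᵀ)) =
      ∑ j, ∑ i, p j * q i * (Vᵀ * U) j i ^ 2 := by
  have h : trace (V * diagonal p * Vᵀ * (U * diagonal q * Uᵀ)) =
      trace (diagonal p * (Vᵀ * U) * diagonal q * (Vᵀ * U)ᵀ) := by
    rw [transpose_mul, transpose_transpose]
    simp only [Matrix.mul_assoc]
    rw [trace_mul_comm V]
    simp only [Matrix.mul_assoc]
  rw [h, trace]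
  refine Finset.sum_congr rfl fun j _ => ?_
  rw [diag_apply, mul_apply]
  refine Finset.sum_congr rfl fun i _ => ?_
  rw [mul_diagonal, diagonal_mul, transpose_apply]
  ring

theorem IsHermitian.eq_conj_diagonal {X : Matrix ι ι ℝ} (hX : X.IsHermitian) :
    X = (hX.eigenvectorUnitary : Matrix ι ι ℝ) * diagonal hX.eigenvalues *
      (hX.eigenvectorUnitary : Matrix ι ι ℝ)ᵀ := by
  conv_lhs => rw [hX.spectral_theorem]
  rw [Unitary.conjStarAlgAut_apply]
  rfl

theorem IsHermitian.transpose_eigenvectorUnitary_mul_self {X : Matrix ι ι ℝ}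
    (hX : X.IsHermitian) :
    (hX.eigenvectorUnitary : Matrix ι ι ℝ)ᵀ * (hX.eigenvectorUnitary : Matrix ι ι ℝ) = 1 :=
  Unitary.coe_star_mul_self hX.eigenvectorUnitary

/-- The derivative of `t ↦ t ^ τ`, applied to a Hermitian matrix by spectral calculus. -/
noncomputable def IsHermitian.rpowDeriv {X : Matrix ι ι ℝ} (hX : X.IsHermitian) (τ : ℝ) :
    Matrix ι ι ℝ :=
  (hX.eigenvectorUnitary : Matrix ι ι ℝ) * diagonal (fun i => τ * hX.eigenvalues i ^ (τ - 1)) *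
    (hX.eigenvectorUnitary : Matrix ι ι ℝ)ᵀ

/-- The gap in Klein's inequality, as a nonnegative combination of scalar tangent gaps. -/
theorem klein_gap_eq {τ : ℝ} {X : Matrix ι ι ℝ} (hX : X.IsHermitian) {U : Matrix ι ι ℝ}
    (hU : Uᵀ * U = 1) (l : ι → ℝ) :
    ∑ i, hX.eigenvalues i ^ τ + trace (hX.rpowDeriv τ * (U * diagonal l * Uᵀ - X)) -
        ∑ i, l i ^ τ =
      ∑ j, ∑ i, (hX.eigenvalues j ^ τ + τ * hX.eigenvalues j ^ (τ - 1) *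
        (l i - hX.eigenvalues j) - l i ^ τ) *
          ((hX.eigenvectorUnitary : Matrix ι ι ℝ)ᵀ * U) j i ^ 2 := by
  set V := (hX.eigenvectorUnitary : Matrix ι ι ℝ) with hVdef
  have hV : Vᵀ * V = 1 := hX.transpose_eigenvectorUnitary_mul_self
  have hU' : U * Uᵀ = 1 := mul_eq_one_comm.1 hU
  have hV' : V * Vᵀ = 1 := mul_eq_one_comm.1 hV
  have key := fun p q => trace_diagonal_conj_mul_diagonal_conj U V p q
  have diag_tr : ∀ (W : Matrix ι ι ℝ) (p : ι → ℝ), Wᵀ * W = 1 →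
      trace (W * diagonal p * Wᵀ) = ∑ i, p i := by
    intro W p hW
    rw [trace_mul_comm, ← Matrix.mul_assoc, hW, Matrix.one_mul, trace_diagonal]
  have h1 := key (fun j => hX.eigenvalues j ^ τ) (fun _ => 1)
  rw [diagonal_one, Matrix.mul_one, hU', Matrix.mul_one, diag_tr V _ hV] at h1
  have h2 := key (fun _ => 1) (fun i => l i ^ τ)
  rw [diagonal_one, Matrix.mul_one, hV', Matrix.one_mul, diag_tr U _ hU] at h2
  have h3 := key (fun j => τ * hX.eigenvalues j ^ (τ - 1)) l
  have h4 := key (fun j => τ * hX.eigenvalues j ^ (τ - 1) * hX.eigenvalues j) (fun _ => 1)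
  rw [diagonal_one, Matrix.mul_one, hU', Matrix.mul_one] at h4
  have h5 : hX.rpowDeriv τ * X =
      V * diagonal (fun j => τ * hX.eigenvalues j ^ (τ - 1) * hX.eigenvalues j) * Vᵀ := by
    calc hX.rpowDeriv τ * X = V * diagonal (fun j => τ * hX.eigenvalues j ^ (τ - 1)) * Vᵀ *
          (V * diagonal hX.eigenvalues * Vᵀ) := congrArg _ hX.eq_conj_diagonal
      _ = V * diagonal (fun j => τ * hX.eigenvalues j ^ (τ - 1)) * (Vᵀ * V) *
          diagonal hX.eigenvalues * Vᵀ := by simp only [Matrix.mul_assoc]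
      _ = _ := by rw [hV, Matrix.mul_one, Matrix.mul_assoc V, diagonal_mul_diagonal]
  rw [Matrix.mul_sub, trace_sub, h5, h1, h2, h4]
  change _ + (trace (V * _ * Vᵀ * _) - _) - _ = _
  rw [h3]
  simp only [← Finset.sum_add_distrib, ← Finset.sum_sub_distrib]
  refine Finset.sum_congr rfl fun j _ => Finset.sum_congr rfl fun i _ => ?_
  ring

/-- **Klein's inequality** for the trace of a matrix power with exponent in `(0, 1)`. -/
theorem klein_rpow_le {τ : ℝ} (hτ0 : 0 < τ) (hτ1 : τ < 1) {X : Matrix ι ι ℝ} (hX : X.PosDef)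
    {U : Matrix ι ι ℝ} (hU : Uᵀ * U = 1) {l : ι → ℝ} (hl : ∀ i, 0 ≤ l i) :
    ∑ i, l i ^ τ ≤ ∑ i, hX.1.eigenvalues i ^ τ +
      trace (hX.1.rpowDeriv τ * (U * diagonal l * Uᵀ - X)) := by
  rw [← sub_nonneg, klein_gap_eq hX.1 hU]
  refine Finset.sum_nonneg fun j _ => Finset.sum_nonneg fun i _ => mul_nonneg ?_ (sq_nonneg _)
  exact sub_nonneg.2 (Real.rpow_le_tangent hτ0 hτ1 (hl i) (hX.eigenvalues_pos j))

theorem eq_of_klein_rpow_eq {τ : ℝ} (hτ0 : 0 < τ) (hτ1 : τ < 1) {X : Matrix ι ι ℝ}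
    (hX : X.PosDef) {U : Matrix ι ι ℝ} (hU : Uᵀ * U = 1) {l : ι → ℝ} (hl : ∀ i, 0 ≤ l i)
    (h : ∑ i, l i ^ τ = ∑ i, hX.1.eigenvalues i ^ τ +
      trace (hX.1.rpowDeriv τ * (U * diagonal l * Uᵀ - X))) :
    U * diagonal l * Uᵀ = X := by
  have hgap := klein_gap_eq (τ := τ) hX.1 hU l
  rw [← h, sub_self] at hgap
  have hnn : ∀ j i, 0 ≤ (hX.1.eigenvalues j ^ τ + τ * hX.1.eigenvalues j ^ (τ - 1) *
        (l i - hX.1.eigenvalues j) - l i ^ τ) *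
          ((hX.1.eigenvectorUnitary : Matrix ι ι ℝ)ᵀ * U) j i ^ 2 := fun j i =>
    mul_nonneg (sub_nonneg.2 (Real.rpow_le_tangent hτ0 hτ1 (hl i) (hX.eigenvalues_pos j)))
      (sq_nonneg _)
  have hzero := (Finset.sum_eq_zero_iff_of_nonneg
    fun j _ => Finset.sum_nonneg fun i _ => hnn j i).1 hgap.symm
  set V := (hX.1.eigenvectorUnitary : Matrix ι ι ℝ) with hVdef
  have hV' : V * Vᵀ = 1 := mul_eq_one_comm.1 hX.1.transpose_eigenvectorUnitary_mul_self
  have hU' : U * Uᵀ = 1 := mul_eq_one_comm.1 hU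
  have hcomm : Vᵀ * U * diagonal l = diagonal hX.1.eigenvalues * (Vᵀ * U) := by
    ext j i
    rw [mul_diagonal, diagonal_mul]
    rcases mul_eq_zero.1 ((Finset.sum_eq_zero_iff_of_nonneg fun i _ => hnn j i).1
      (hzero j (Finset.mem_univ j)) i (Finset.mem_univ i)) with h0 | h0
    · rw [Real.eq_of_rpow_eq_tangent hτ0 hτ1 (hl i) (hX.eigenvalues_pos j)
        (sub_eq_zero.1 h0).symm, mul_comm]
    · rw [pow_eq_zero_iff two_ne_zero] at h0
      rw [h0]; ring
  calc U * diagonal l * Uᵀ = V * (Vᵀ * U * diagonal l) * Uᵀ := by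
        rw [← Matrix.mul_assoc, ← Matrix.mul_assoc, hV', Matrix.one_mul]
    _ = V * diagonal hX.1.eigenvalues * Vᵀ * (U * Uᵀ) := by
        rw [hcomm]; simp only [Matrix.mul_assoc]
    _ = X := by rw [hU', Matrix.mul_one]; exact hX.1.eq_conj_diagonal.symm

theorem PosSemidef.trace_mul_nonneg_of_conj_diagonal {P V : Matrix ι ι ℝ} (hP : P.PosSemidef)
    {g : ι → ℝ} (hg : ∀ i, 0 ≤ g i) : 0 ≤ trace (V * diagonal g * Vᵀ * P) := by
  have h : trace (V * diagonal g * Vᵀ * P) = trace (diagonal g * (Vᵀ * P * V)) := by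
    simp only [Matrix.mul_assoc]
    rw [trace_mul_comm V]
    simp only [Matrix.mul_assoc]
  rw [h, trace]
  refine Finset.sum_nonneg fun i _ => ?_
  rw [diag_apply, diagonal_mul]
  exact mul_nonneg (hg i) (hP.conjTranspose_mul_mul_same V).diag_nonneg

/-- Trace monotonicity of matrix powers with exponent in `(0, 1)`. -/
theorem sum_rpow_le_of_posSemidef_sub {τ : ℝ} (hτ0 : 0 < τ) (hτ1 : τ < 1) {X : Matrix ι ι ℝ}
    (hX : X.PosDef) {U : Matrix ι ι ℝ} (hU : Uᵀ * U = 1) {l : ι → ℝ} (hl : ∀ i, 0 ≤ l i)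
    (hle : (X - U * diagonal l * Uᵀ).PosSemidef) :
    ∑ i, l i ^ τ ≤ ∑ i, hX.1.eigenvalues i ^ τ := by
  have h1 := klein_rpow_le hτ0 hτ1 hX hU hl
  have h2 : 0 ≤ trace (hX.1.rpowDeriv τ * (X - U * diagonal l * Uᵀ)) :=
    hle.trace_mul_nonneg_of_conj_diagonal fun i => by
      have := hX.eigenvalues_pos i
      positivity
  rw [← neg_sub X, Matrix.mul_neg, trace_neg] at h1
  linarith

theorem PosDef.exists_posSemidef_sub_smul_one {X : Matrix ι ι ℝ} (hX : X.PosDef) :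
    ∃ c : ℝ, 0 < c ∧ (X - c • (1 : Matrix ι ι ℝ)).PosSemidef := by
  rcases isEmpty_or_nonempty ι with hι | hι
  · refine ⟨1, one_pos, ?_⟩
    rw [Subsingleton.elim (X - (1 : ℝ) • (1 : Matrix ι ι ℝ)) 0]
    exact PosSemidef.zero
  obtain ⟨i₀, hi₀⟩ := Finite.exists_min hX.1.eigenvalues
  refine ⟨_, hX.eigenvalues_pos i₀, ?_⟩
  set V := (hX.1.eigenvectorUnitary : Matrix ι ι ℝ) with hVdef
  have hV' : V * Vᵀ = 1 := mul_eq_one_comm.1 hX.1.transpose_eigenvectorUnitary_mul_self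
  have h : X - hX.1.eigenvalues i₀ • (1 : Matrix ι ι ℝ) =
      V * diagonal (fun i => hX.1.eigenvalues i - hX.1.eigenvalues i₀) * Vᴴ := by
    have hd : diagonal (fun i => hX.1.eigenvalues i - hX.1.eigenvalues i₀) =
        diagonal hX.1.eigenvalues - hX.1.eigenvalues i₀ • (1 : Matrix ι ι ℝ) := by
      rw [smul_one_eq_diagonal, diagonal_sub]
    rw [hd, conjTranspose_eq_transpose_of_trivial, Matrix.mul_sub, Matrix.sub_mul,
      ← hX.1.eq_conj_diagonal, Matrix.mul_smul, Matrix.mul_one, Matrix.smul_mul, hV']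
  rw [h]
  exact (PosSemidef.diagonal fun i => sub_nonneg.2 (hi₀ i)).mul_mul_conjTranspose_same V

end Matrix

theorem mPowR_eq_cfc {n : ℕ} {X : Matrix (Fin n) (Fin n) ℝ} (hX : X.IsHermitian) (τ : ℝ) :
    mPowR X τ = cfc (fun x : ℝ => x ^ τ) X := by
  rw [mPowR, dif_pos hX, hX.cfc_eq, Matrix.IsHermitian.cfc, Unitary.conjStarAlgAut_apply]
  rfl

theorem trace_mPowR {n : ℕ} {X : Matrix (Fin n) (Fin n) ℝ} (hX : X.IsHermitian) (τ : ℝ) :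
    trace (mPowR X τ) = ∑ i, hX.eigenvalues i ^ τ := by
  rw [mPowR, dif_pos hX, trace_mul_comm, ← Matrix.mul_assoc, Unitary.coe_star_mul_self,
    Matrix.one_mul, trace_diagonal]

namespace Matrix

variable {ι : Type*} [Fintype ι]

theorem isClosed_setOf_posSemidef : IsClosed {X : Matrix ι ι ℝ | X.PosSemidef} := by
  have h : {X : Matrix ι ι ℝ | X.PosSemidef} =
      {X | Xᴴ = X} ∩ ⋂ x : ι → ℝ, {X | 0 ≤ star x ⬝ᵥ (X *ᵥ x)} := by
    ext X
    simp [posSemidef_iff_dotProduct_mulVec, IsHermitian]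
  rw [h]
  refine (isClosed_eq (by fun_prop) continuous_id).inter (isClosed_iInter fun x => ?_)
  exact isClosed_le continuous_const (by fun_prop)

theorem PosSemidef.abs_apply_le_trace {X : Matrix ι ι ℝ} (hX : X.PosSemidef) (i j : ι) :
    |X i j| ≤ X.trace := by
  classical
  have hsymm : X j i = X i j := by simpa using congrFun (congrFun hX.1 i) j
  have hdiag : ∀ k, X k k ≤ X.trace := fun k =>
    Finset.single_le_sum (f := fun k => X k k) (fun k _ => hX.diag_nonneg) (Finset.mem_univ k)
  have quad : ∀ s : ℝ, star (Pi.single i 1 + s • Pi.single j 1 : ι → ℝ) ⬝ᵥ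
      (X *ᵥ (Pi.single i 1 + s • Pi.single j 1)) = X i i + 2 * s * X i j + s ^ 2 * X j j := by
    intro s
    simp [mulVec_add, mulVec_smul, add_dotProduct, dotProduct_add, hsymm]
    ring
  have h1 := hX.dotProduct_mulVec_nonneg (Pi.single i 1 + (1 : ℝ) • Pi.single j 1)
  have h2 := hX.dotProduct_mulVec_nonneg (Pi.single i 1 + (-1 : ℝ) • Pi.single j 1)
  rw [quad] at h1 h2
  have := hdiag i
  have := hdiag j
  rw [abs_le]
  constructor <;> linarith

theorem isCompact_setOf_posSemidef_trace_le (R : ℝ) :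
    IsCompact {X : Matrix ι ι ℝ | X.PosSemidef ∧ X.trace ≤ R} := by
  have hbox : IsCompact {X : Matrix ι ι ℝ | ∀ i, X i ∈ {r | ∀ j, r j ∈ Set.Icc (-R) R}} :=
    isCompact_pi_infinite fun _ => isCompact_pi_infinite fun _ => isCompact_Icc
  refine hbox.of_isClosed_subset ?_ ?_
  · exact isClosed_setOf_posSemidef.inter
      (isClosed_le continuous_id.matrix_trace continuous_const)
  · rintro X ⟨hX, hR⟩ i j
    exact abs_le.1 ((hX.abs_apply_le_trace i j).trans hR)

theorem PosSemidef.spectrum_subset_Icc_trace [DecidableEq ι] {X : Matrix ι ι ℝ}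
    (hX : X.PosSemidef) : spectrum ℝ X ⊆ Set.Icc 0 X.trace := by
  rw [hX.1.spectrum_real_eq_range_eigenvalues]
  rintro _ ⟨i, rfl⟩
  refine ⟨hX.eigenvalues_nonneg i, ?_⟩
  rw [hX.1.trace_eq_sum_eigenvalues]
  exact Finset.single_le_sum (f := hX.1.eigenvalues) (fun i _ => hX.eigenvalues_nonneg i)
    (Finset.mem_univ i)

end Matrix

open scoped Matrix.Norms.L2Operator in
theorem continuousOn_mPowR {n : ℕ} {τ : ℝ} (hτ : 0 ≤ τ) (R : ℝ) :
    ContinuousOn (fun X : Matrix (Fin n) (Fin n) ℝ => mPowR X τ)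
      {X | X.PosSemidef ∧ X.trace ≤ R} := by
  have h := continuousOn_cfc (p := IsSelfAdjoint) (Matrix (Fin n) (Fin n) ℝ)
    (isCompact_Icc (a := (0 : ℝ)) (b := R)) (fun x : ℝ => x ^ τ)
    (Real.continuous_rpow_const hτ).continuousOn
  refine (h.mono ?_).congr fun X hX => mPowR_eq_cfc hX.1.1 τ
  rintro X ⟨hX, hR⟩
  exact ⟨hX.1, hX.spectrum_subset_Icc_trace.trans (Set.Icc_subset_Icc_right hR)⟩

/-- The `X`-dependent part of the divergence `D_T^{(τ)}(X‖I)`, up to the factor `1 / (1 - τ)`. -/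
noncomputable def traceSubRpow {n : ℕ} (τ : ℝ) (X : Matrix (Fin n) (Fin n) ℝ) : ℝ :=
  trace X - 1 / τ * trace (mPowR X τ)

theorem exists_half_trace_sub_le_traceSubRpow {n : ℕ} {τ : ℝ} (hτ0 : 0 < τ) (hτ1 : τ < 1) :
    ∃ K : ℝ, ∀ X : Matrix (Fin n) (Fin n) ℝ, X.PosSemidef →
      trace X / 2 - K ≤ traceSubRpow τ X := by
  set s : ℝ := (1 / 2) ^ (1 / (τ - 1)) with hs
  have hs0 : 0 < s := by positivity
  have hs1 : s ^ (τ - 1) = 1 / 2 := by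
    rw [hs, ← Real.rpow_mul (by norm_num), one_div_mul_cancel (by linarith), Real.rpow_one]
  refine ⟨∑ _ : Fin n, s ^ τ / τ, fun X hX => ?_⟩
  have key : 1 / τ * ∑ i, hX.1.eigenvalues i ^ τ ≤
      (∑ i, hX.1.eigenvalues i) / 2 + ∑ _ : Fin n, s ^ τ / τ := by
    rw [Finset.mul_sum, Finset.sum_div, ← Finset.sum_add_distrib]
    refine Finset.sum_le_sum fun i _ => ?_
    have h := Real.rpow_le_tangent hτ0 hτ1 (hX.eigenvalues_nonneg i) hs0
    rw [hs1] at h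
    calc 1 / τ * hX.1.eigenvalues i ^ τ
        ≤ 1 / τ * (s ^ τ + τ * (1 / 2) * (hX.1.eigenvalues i - s)) := by gcongr
      _ = hX.1.eigenvalues i / 2 + s ^ τ / τ - s / 2 := by field_simp; ring
      _ ≤ _ := by linarith
  have htr : trace X = ∑ i, hX.1.eigenvalues i := hX.1.trace_eq_sum_eigenvalues
  rw [traceSubRpow, trace_mPowR hX.1, htr]
  linarith

theorem exists_isMinOn_traceSubRpow {n : ℕ} {τ : ℝ} (hτ0 : 0 < τ) (hτ1 : τ < 1)
    (S : Submodule ℝ (Matrix (Fin n) (Fin n) ℝ)) :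
    ∃ X ∈ S, X.PosSemidef ∧
      ∀ Y ∈ S, Y.PosSemidef → traceSubRpow τ X ≤ traceSubRpow τ Y := by
  obtain ⟨K, hK⟩ := exists_half_trace_sub_le_traceSubRpow (n := n) hτ0 hτ1
  set R : ℝ := max 0 (2 * (traceSubRpow τ (0 : Matrix (Fin n) (Fin n) ℝ) + K)) with hR
  have hcomp : IsCompact ({X : Matrix (Fin n) (Fin n) ℝ | X.PosSemidef ∧ X.trace ≤ R} ∩ S) :=
    (isCompact_setOf_posSemidef_trace_le R).inter_right S.closed_of_finiteDimensional
  have h0mem : (0 : Matrix (Fin n) (Fin n) ℝ) ∈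
      ({X : Matrix (Fin n) (Fin n) ℝ | X.PosSemidef ∧ X.trace ≤ R} ∩ S : Set _) :=
    ⟨⟨PosSemidef.zero, by simp [hR]⟩, S.zero_mem⟩
  have hcont : ContinuousOn (traceSubRpow τ)
      ({X : Matrix (Fin n) (Fin n) ℝ | X.PosSemidef ∧ X.trace ≤ R} ∩ S) := by
    have h := (continuousOn_mPowR (n := n) hτ0.le R).mono
      (Set.inter_subset_left (t := (S : Set _)))
    have htr : Continuous (trace : Matrix (Fin n) (Fin n) ℝ → ℝ) := continuous_id.matrix_trace
    exact htr.continuousOn.sub (continuousOn_const.mul (htr.comp_continuousOn h))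
  obtain ⟨X, hX, hmin⟩ := hcomp.exists_isMinOn ⟨0, h0mem⟩ hcont
  refine ⟨X, hX.2, hX.1.1, fun Y hYS hY => ?_⟩
  by_cases hYR : Y.trace ≤ R
  · exact hmin ⟨⟨hY, hYR⟩, hYS⟩
  · refine (hmin h0mem).trans ?_
    have h1 := hK Y hY
    have h2 := le_max_right 0 (2 * (traceSubRpow τ (0 : Matrix (Fin n) (Fin n) ℝ) + K))
    rw [← hR] at h2
    linarith

/-- A lower bound for `trace (Z ^ τ)` along the segment from `X` to `Y` when `c • 1 ≤ Y`. -/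
theorem sum_rpow_lineMap_le {n : ℕ} {τ : ℝ} (hτ0 : 0 < τ) (hτ1 : τ < 1)
    {X Y : Matrix (Fin n) (Fin n) ℝ} (hX : X.PosSemidef) {c : ℝ} (hc : 0 < c)
    (hY : (Y - c • (1 : Matrix (Fin n) (Fin n) ℝ)).PosSemidef) {t : ℝ} (ht0 : 0 < t)
    (ht1 : t < 1) (hZ : ((1 - t) • X + t • Y).PosDef) :
    ∑ i, ((1 - t) * hX.1.eigenvalues i + t * c) ^ τ ≤ ∑ i, hZ.1.eigenvalues i ^ τ := by
  have hU := hX.1.transpose_eigenvectorUnitary_mul_self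
  set U := (hX.1.eigenvectorUnitary : Matrix (Fin n) (Fin n) ℝ) with hUdef
  have hU' : U * Uᵀ = 1 := mul_eq_one_comm.1 hU
  refine sum_rpow_le_of_posSemidef_sub hτ0 hτ1 hZ hU (fun i => ?_) ?_
  · have := hX.eigenvalues_nonneg i
    have : 0 ≤ 1 - t := by linarith
    positivity
  · have hd : diagonal (fun i => (1 - t) * hX.1.eigenvalues i + t * c) =
        (1 - t) • diagonal hX.1.eigenvalues + (t * c) • (1 : Matrix (Fin n) (Fin n) ℝ) := by
      rw [smul_one_eq_diagonal, ← diagonal_smul, diagonal_add]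
      rfl
    have hconj : U * diagonal (fun i => (1 - t) * hX.1.eigenvalues i + t * c) * Uᵀ =
        (1 - t) • X + (t * c) • (1 : Matrix (Fin n) (Fin n) ℝ) := by
      rw [hd, Matrix.mul_add, Matrix.add_mul, Matrix.mul_smul, Matrix.mul_smul, Matrix.smul_mul,
        Matrix.smul_mul, Matrix.mul_one, hU', ← hX.1.eq_conj_diagonal]
    rw [hconj, add_sub_add_left_eq_sub, mul_smul, ← smul_sub]
    exact hY.smul ht0.le

theorem posDef_of_isMinOn_traceSubRpow {n : ℕ} {τ : ℝ} (hτ0 : 0 < τ) (hτ1 : τ < 1)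
    {S : Submodule ℝ (Matrix (Fin n) (Fin n) ℝ)} (hS : ∃ Y ∈ S, Y.PosDef)
    {X : Matrix (Fin n) (Fin n) ℝ} (hXS : X ∈ S) (hX : X.PosSemidef)
    (hmin : ∀ Y ∈ S, Y.PosSemidef → traceSubRpow τ X ≤ traceSubRpow τ Y) : X.PosDef := by
  rw [hX.1.posDef_iff_eigenvalues_pos]
  by_contra hneg
  push Not at hneg
  obtain ⟨i₀, hi₀⟩ := hneg
  replace hi₀ : hX.1.eigenvalues i₀ = 0 := le_antisymm hi₀ (hX.eigenvalues_nonneg i₀)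
  obtain ⟨Y, hYS, hY⟩ := hS
  obtain ⟨c, hc, hYc⟩ := hY.exists_posSemidef_sub_smul_one
  have step : ∀ t ∈ Set.Ioo (0 : ℝ) 1,
      t ^ (τ - 1) * (c ^ τ / τ) ≤ trace Y - traceSubRpow τ X := by
    rintro t ⟨ht0, ht1⟩
    have h1t : 0 ≤ 1 - t := by linarith
    have hZ : ((1 - t) • X + t • Y).PosDef := PosDef.posSemidef_add (hX.smul h1t) (hY.smul ht0)
    have hle := sum_rpow_lineMap_le hτ0 hτ1 hX hc hYc ht0 ht1 hZ
    have hlow : (1 - t) * ∑ i, hX.1.eigenvalues i ^ τ + (t * c) ^ τ ≤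
        ∑ i, ((1 - t) * hX.1.eigenvalues i + t * c) ^ τ := by
      have hsplit : (t * c) ^ τ = ∑ i, if i = i₀ then (t * c) ^ τ else 0 := by simp
      rw [hsplit, Finset.mul_sum, ← Finset.sum_add_distrib]
      refine Finset.sum_le_sum fun i _ => ?_
      have hnn := hX.eigenvalues_nonneg i
      split_ifs with h
      · rw [h, hi₀, Real.zero_rpow hτ0.ne', mul_zero, zero_add, zero_add]
      · have hpow : 1 - t ≤ (1 - t) ^ τ :=
          Real.self_le_rpow_of_le_one h1t (by linarith) hτ1.le
        calc (1 - t) * hX.1.eigenvalues i ^ τ + 0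
            ≤ (1 - t) ^ τ * hX.1.eigenvalues i ^ τ := by rw [add_zero]; gcongr
          _ = ((1 - t) * hX.1.eigenvalues i) ^ τ := (Real.mul_rpow h1t hnn).symm
          _ ≤ _ := by
            refine Real.rpow_le_rpow (by positivity) ?_ hτ0.le
            linarith [mul_pos ht0 hc]
    have hF := hmin _ (S.add_mem (S.smul_mem (1 - t) hXS) (S.smul_mem t hYS)) hZ.posSemidef
    rw [traceSubRpow, traceSubRpow, trace_mPowR hX.1, trace_mPowR hZ.1, trace_add, trace_smul,
      trace_smul, smul_eq_mul, smul_eq_mul] at hF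
    rw [traceSubRpow, trace_mPowR hX.1]
    have hmul := mul_le_mul_of_nonneg_left (hlow.trans hle) (one_div_pos.2 hτ0).le
    have hpow : (t * c) ^ τ = t * (t ^ (τ - 1) * c ^ τ) := by
      rw [Real.mul_rpow ht0.le hc.le, Real.rpow_sub_one ht0.ne']
      field_simp
    rw [hpow] at hmul
    refine le_of_mul_le_mul_left ?_ ht0
    calc t * (t ^ (τ - 1) * (c ^ τ / τ)) = 1 / τ * (t * (t ^ (τ - 1) * c ^ τ)) := by ring
      _ ≤ _ := by linarith
  have htend := (tendsto_rpow_neg_nhdsGT_zero (y := τ - 1) (by linarith)).atTop_mul_const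
    (show 0 < c ^ τ / τ by positivity)
  obtain ⟨t, ht, htgt⟩ := ((Filter.eventually_mem_set.2 (Ioo_mem_nhdsGT (zero_lt_one' ℝ))).and
    (htend.eventually_gt_atTop (trace Y - traceSubRpow τ X))).exists
  have := step t ht
  linarith

theorem eq_of_isMinOn_traceSubRpow {n : ℕ} {τ : ℝ} (hτ0 : 0 < τ) (hτ1 : τ < 1)
    {S : Submodule ℝ (Matrix (Fin n) (Fin n) ℝ)} {X Y : Matrix (Fin n) (Fin n) ℝ}
    (hXS : X ∈ S) (hX : X.PosDef) (hYS : Y ∈ S) (hY : Y.PosDef)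
    (hXmin : ∀ Z ∈ S, Z.PosDef → traceSubRpow τ X ≤ traceSubRpow τ Z)
    (hYmin : ∀ Z ∈ S, Z.PosDef → traceSubRpow τ Y ≤ traceSubRpow τ Z) : X = Y := by
  have hZ : ((1 / 2 : ℝ) • X + (1 / 2 : ℝ) • Y).PosDef :=
    (hX.smul (by norm_num)).add (hY.smul (by norm_num))
  have hZS := S.add_mem (S.smul_mem (1 / 2) hXS) (S.smul_mem (1 / 2) hYS)
  set Z := (1 / 2 : ℝ) • X + (1 / 2 : ℝ) • Y with hZdef
  have hXZ := hXmin Z hZS hZ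
  have hYZ := hYmin Z hZS hZ
  have kX := klein_rpow_le hτ0 hτ1 hZ hX.1.transpose_eigenvectorUnitary_mul_self
    fun i => (hX.eigenvalues_pos i).le
  have kY := klein_rpow_le hτ0 hτ1 hZ hY.1.transpose_eigenvectorUnitary_mul_self
    fun i => (hY.eigenvalues_pos i).le
  have eX := eq_of_klein_rpow_eq hτ0 hτ1 hZ hX.1.transpose_eigenvectorUnitary_mul_self
    fun i => (hX.eigenvalues_pos i).le
  rw [← hX.1.eq_conj_diagonal] at kX eX
  rw [← hY.1.eq_conj_diagonal] at kY
  have hsum : trace (hZ.1.rpowDeriv τ * (X - Z)) + trace (hZ.1.rpowDeriv τ * (Y - Z)) = 0 := by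
    rw [← trace_add, ← Matrix.mul_add]
    have : X - Z + (Y - Z) = 0 := by
      rw [hZdef]; module
    rw [this, Matrix.mul_zero, trace_zero]
  have htr : trace Z = 1 / 2 * trace X + 1 / 2 * trace Y := by
    rw [hZdef, trace_add, trace_smul, trace_smul, smul_eq_mul, smul_eq_mul]
  rw [traceSubRpow, traceSubRpow, trace_mPowR hZ.1, htr] at hXZ hYZ
  rw [trace_mPowR hX.1] at hXZ
  rw [trace_mPowR hY.1] at hYZ
  have hle : ∑ i, hZ.1.eigenvalues i ^ τ + ∑ i, hZ.1.eigenvalues i ^ τ ≤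
      ∑ i, hX.1.eigenvalues i ^ τ + ∑ i, hY.1.eigenvalues i ^ τ := by
    refine le_of_mul_le_mul_left ?_ (one_div_pos.2 hτ0)
    linarith
  have hXeqZ : X = Z := eX (by linarith)
  have h2 : (1 / 2 : ℝ) • X = (1 / 2 : ℝ) • Y := by
    refine add_left_cancel (a := (1 / 2 : ℝ) • X) (Eq.trans ?_ (hXeqZ.trans hZdef))
    module
  exact smul_right_injective _ (by norm_num : (1 / 2 : ℝ) ≠ 0) h2

theorem existsUnique_isMinOn_traceSubRpow {n : ℕ} {τ : ℝ} (hτ0 : 0 < τ) (hτ1 : τ < 1)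
    {S : Submodule ℝ (Matrix (Fin n) (Fin n) ℝ)} (hS : ∃ Y ∈ S, Y.PosDef) :
    ∃! X, X ∈ S ∧ X.PosDef ∧ ∀ Y ∈ S, Y.PosDef → traceSubRpow τ X ≤ traceSubRpow τ Y := by
  obtain ⟨X, hXS, hX, hmin⟩ := exists_isMinOn_traceSubRpow hτ0 hτ1 S
  refine ⟨X, ⟨hXS, posDef_of_isMinOn_traceSubRpow hτ0 hτ1 hS hXS hX hmin,
    fun Y hYS hY => hmin Y hYS hY.posSemidef⟩, ?_⟩
  rintro Y ⟨hYS, hY, hYmin⟩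
  exact eq_of_isMinOn_traceSubRpow hτ0 hτ1 hYS hY hXS
    (posDef_of_isMinOn_traceSubRpow hτ0 hτ1 hS hXS hX hmin) hYmin
    fun Z hZS hZ => hmin Z hZS hZ.posSemidef

namespace Matrix

theorem mulVec_injective_of_rank_eq_card {ι κ : Type*} [Fintype ι] [Fintype κ]
    {M : Matrix ι κ ℝ} (hM : M.rank = Fintype.card κ) : Function.Injective M.mulVec := by
  have h := M.mulVecLin.finrank_range_add_finrank_ker
  rw [Module.finrank_fintype_fun_eq_card] at h
  change M.rank + _ = _ at h
  have hker : LinearMap.ker M.mulVecLin = ⊥ := Submodule.finrank_eq_zero.1 (by omega)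
  exact LinearMap.ker_eq_bot.1 hker

open scoped Matrix.Norms.Operator in
theorem exists_eventually_abs_pow_apply_le {ι : Type*} [Fintype ι] [DecidableEq ι]
    {A : Matrix ι ι ℝ} (hA : spectralRadius ℂ (A.map (algebraMap ℝ ℂ)) < 1) :
    ∃ r : ℝ, 0 ≤ r ∧ r < 1 ∧ ∀ᶠ k : ℕ in Filter.atTop, ∀ i j, |(A ^ k) i j| ≤ r ^ k := by
  obtain ⟨r, hr, hr1⟩ := ENNReal.lt_iff_exists_nnreal_btwn.1 hA
  refine ⟨r, r.2, by exact_mod_cast hr1, ?_⟩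
  have htend := spectrum.pow_nnnorm_pow_one_div_tendsto_nhds_spectralRadius
    (A.map (algebraMap ℝ ℂ))
  filter_upwards [htend.eventually_lt_const hr, Filter.eventually_gt_atTop 0] with k hk hk0 i j
  have hk' : ‖(A.map (algebraMap ℝ ℂ)) ^ k‖₊ ≤ r ^ k := by
    have h : ((‖(A.map (algebraMap ℝ ℂ)) ^ k‖₊ : ENNReal) ^ (1 / k : ℝ)) ^ (k : ℝ) ≤
        (r : ENNReal) ^ (k : ℝ) := ENNReal.rpow_le_rpow hk.le k.cast_nonneg
    rw [← ENNReal.rpow_mul, one_div_mul_cancel (by positivity), ENNReal.rpow_one,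
      ENNReal.rpow_natCast] at h
    exact_mod_cast h
  have hentry : ‖((A.map (algebraMap ℝ ℂ)) ^ k) i j‖₊ ≤ ‖(A.map (algebraMap ℝ ℂ)) ^ k‖₊ := by
    rw [linfty_opNNNorm_def]
    exact (Finset.single_le_sum
      (f := fun j => ‖((A.map (algebraMap ℝ ℂ)) ^ k) i j‖₊) (fun _ _ => zero_le)
      (Finset.mem_univ j)).trans (Finset.le_sup
        (f := fun i => ∑ j, ‖((A.map (algebraMap ℝ ℂ)) ^ k) i j‖₊) (Finset.mem_univ i))
  have hmap : (A.map (algebraMap ℝ ℂ)) ^ k = (A ^ k).map (algebraMap ℝ ℂ) :=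
    (map_pow (algebraMap ℝ ℂ).mapMatrix A k).symm
  have h : ‖((A ^ k).map (algebraMap ℝ ℂ)) i j‖ ≤ (r : ℝ) ^ k := by
    rw [← hmap]
    exact_mod_cast hentry.trans hk'
  simpa using h

theorem summable_pow_mul_mul_transpose {ι κ : Type*} [Fintype ι] [DecidableEq ι] [Fintype κ]
    {A : Matrix ι ι ℝ} (hA : spectralRadius ℂ (A.map (algebraMap ℝ ℂ)) < 1) (B : Matrix ι κ ℝ) :
    Summable fun k : ℕ => A ^ k * B * (A ^ k * B)ᵀ := by
  obtain ⟨r, hr0, hr1, hr⟩ := exists_eventually_abs_pow_apply_le hA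
  have hprod : ∀ i a j b, Summable fun k : ℕ => (A ^ k) i a * (A ^ k) j b := by
    intro i a j b
    refine (summable_geometric_of_lt_one hr0 hr1).of_norm_bounded_eventually_nat ?_
    filter_upwards [hr] with k hk
    rw [norm_mul]
    calc ‖(A ^ k) i a‖ * ‖(A ^ k) j b‖ ≤ r ^ k * 1 :=
          mul_le_mul (hk i a) ((hk j b).trans (pow_le_one₀ hr0 hr1.le)) (norm_nonneg _)
            (by positivity)
      _ = r ^ k := mul_one _
  refine Pi.summable.2 fun i => Pi.summable.2 fun j => ?_
  have hentry : ∀ k : ℕ, (A ^ k * B * (A ^ k * B)ᵀ) i j =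
      ∑ c, ∑ a, ∑ b, (A ^ k) i a * (A ^ k) j b * (B a c * B b c) := by
    intro k
    rw [mul_apply]
    refine Finset.sum_congr rfl fun c _ => ?_
    rw [transpose_apply, mul_apply, mul_apply, Finset.sum_mul_sum]
    refine Finset.sum_congr rfl fun a _ => Finset.sum_congr rfl fun b _ => ?_
    ring
  simp_rw [hentry]
  exact summable_sum fun c _ => summable_sum fun a _ => summable_sum fun b _ =>
    (hprod i a j b).mul_right _

/-- The discrete-time Lyapunov equation of a stable reachable pair has a positive definite
solution, the reachability Gramian. -/
theorem exists_posDef_sub_mul_mul_transpose_eq {n m : ℕ} {A : Matrix (Fin n) (Fin n) ℝ}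
    (hA : spectralRadius ℂ (A.map (algebraMap ℝ ℂ)) < 1) {B : Matrix (Fin n) (Fin m) ℝ}
    (hreach : (Matrix.of fun (i : Fin n) (p : Fin n × Fin m) =>
      (A ^ (p.1 : ℕ) * B) i p.2).rank = n) :
    ∃ W : Matrix (Fin n) (Fin n) ℝ, W.PosDef ∧ W - A * W * Aᵀ = B * Bᵀ := by
  obtain ⟨W, hW⟩ := summable_pow_mul_mul_transpose hA B
  refine ⟨W, PosDef.of_dotProduct_mulVec_pos ?_ fun x hx => ?_, ?_⟩
  · refine HasSum.unique ?_ hW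
    simpa using hW.matrix_transpose
  · have hquad : HasSum (fun k : ℕ => ((A ^ k * B)ᵀ *ᵥ x) ⬝ᵥ ((A ^ k * B)ᵀ *ᵥ x))
        (star x ⬝ᵥ (W *ᵥ x)) := by
      have h := hW.map (⟨⟨fun M : Matrix (Fin n) (Fin n) ℝ => star x ⬝ᵥ (M *ᵥ x), by simp⟩,
        fun M N => by simp [add_mulVec, dotProduct_add]⟩ : Matrix (Fin n) (Fin n) ℝ →+ ℝ)
        (show Continuous fun M : Matrix (Fin n) (Fin n) ℝ => star x ⬝ᵥ (M *ᵥ x) by fun_prop)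
      convert! h using 2 with k
      change _ = star x ⬝ᵥ ((A ^ k * B * (A ^ k * B)ᵀ) *ᵥ x)
      rw [← mulVec_mulVec, star_trivial, dotProduct_mulVec x, ← mulVec_transpose]
    have hnn : ∀ k : ℕ, 0 ≤ ((A ^ k * B)ᵀ *ᵥ x) ⬝ᵥ ((A ^ k * B)ᵀ *ᵥ x) := fun k =>
      Finset.sum_nonneg fun i _ => mul_self_nonneg _
    refine (hquad.nonneg hnn).lt_of_ne fun h0 => hx ?_
    rw [← h0, hasSum_zero_iff_of_nonneg hnn] at hquad
    have hinj := mulVec_injective_of_rank_eq_card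
      (((rank_transpose _).trans hreach).trans (Fintype.card_fin n).symm)
    refine hinj ?_
    rw [mulVec_zero]
    ext p
    exact congrFun (dotProduct_self_eq_zero.1 (congrFun hquad p.1)) p.2
  · have hshift := (hasSum_nat_add_iff' 1).2 hW
    have hmul : HasSum (fun k : ℕ => A ^ (k + 1) * B * (A ^ (k + 1) * B)ᵀ) (A * W * Aᵀ) := by
      convert! (hW.mul_left A).mul_right Aᵀ using 2 with k
      rw [pow_succ']
      simp only [transpose_mul, Matrix.mul_assoc]
    rw [← hshift.unique hmul]
    simp

end Matrix

/-- The linear space of solutions of `P * (X - A * X * Aᵀ) * P = 0` in the coordinates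
`X = L * Z * Lᵀ`. -/
def conjFeasibleSubmodule {n : ℕ} (P A L : Matrix (Fin n) (Fin n) ℝ) :
    Submodule ℝ (Matrix (Fin n) (Fin n) ℝ) where
  carrier := {Z | P * (L * Z * Lᵀ - A * (L * Z * Lᵀ) * Aᵀ) * P = 0}
  add_mem' {X Y} hX hY := by
    have h : P * (L * (X + Y) * Lᵀ - A * (L * (X + Y) * Lᵀ) * Aᵀ) * P =
        P * (L * X * Lᵀ - A * (L * X * Lᵀ) * Aᵀ) * P +
          P * (L * Y * Lᵀ - A * (L * Y * Lᵀ) * Aᵀ) * P := by noncomm_ring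
    exact h.trans (by rw [hX, hY, add_zero])
  zero_mem' := by simp
  smul_mem' c X hX := by
    have h : P * (L * (c • X) * Lᵀ - A * (L * (c • X) * Lᵀ) * Aᵀ) * P =
        c • (P * (L * X * Lᵀ - A * (L * X * Lᵀ) * Aᵀ) * P) := by
      simp only [Matrix.mul_smul, Matrix.smul_mul, ← smul_sub]
    exact h.trans (by rw [hX, smul_zero])

theorem DtauR_conj {n : ℕ} {τ : ℝ}
    {L : Matrix (Fin n) (Fin n) ℝ} (hL : IsUnit L) (Z : Matrix (Fin n) (Fin n) ℝ) :
    DtauR τ (L * Z * Lᵀ) (L * Lᵀ) L = 1 / (1 - τ) * traceSubRpow τ Z + n / τ := by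
  have hdet : IsUnit L.det := (isUnit_iff_isUnit_det L).1 hL
  have hdet' : IsUnit Lᵀ.det := by rwa [det_transpose]
  have h1 : L⁻¹ * (L * Z * Lᵀ) * (Lᵀ)⁻¹ = Z := by
    rw [Matrix.mul_assoc, mul_nonsing_inv_cancel_right _ _ hdet',
      nonsing_inv_mul_cancel_left _ _ hdet]
  have h2 : trace (L * Z * Lᵀ * (L * Lᵀ)⁻¹) = trace Z := by
    rw [Matrix.mul_inv_rev, ← Matrix.mul_assoc, mul_nonsing_inv_cancel_right _ _ hdet', trace_mul_comm,
      nonsing_inv_mul_cancel_left _ _ hdet]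
  rw [DtauR, h1, trace_sub, trace_smul, trace_smul, h2, traceSubRpow, smul_eq_mul, smul_eq_mul,
    ← neg_sub 1 τ, mul_neg, div_neg, div_neg, one_div_mul_eq_div, one_div, mul_inv]
  ring

/-- the state covariance estimation problem: minimization of
`D_T^{(1−ν⁻¹)}(Σ‖Σ_C)` over the symmetric positive definite matrices satisfying
`Π_B^⊥(Σ − AΣAᵀ)Π_B^⊥ = 0` admits exactly one solution. -/
theorem state_covariance_estimation_unique_solution {n m : ℕ} (hm : 0 < m) (hnm : m < n)
    (A : Matrix (Fin n) (Fin n) ℝ)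
    (hA : spectralRadius ℂ (A.map (algebraMap ℝ ℂ)) < 1)
    (B : Matrix (Fin n) (Fin m) ℝ) (hB : B.rank = m)
    (hreach : (Matrix.of fun (i : Fin n) (p : Fin n × Fin m) =>
      (A ^ (p.1 : ℕ) * B) i p.2).rank = n)
    (SgC : Matrix (Fin n) (Fin n) ℝ) (hSgC : SgC.PosDef)
    (L : Matrix (Fin n) (Fin n) ℝ) (hLtri : ∀ i j : Fin n, i < j → L i j = 0)
    (hLdiag : ∀ i : Fin n, 0 < L i i) (hLSg : L * Lᵀ = SgC)
    (ν : ℕ) (hν : 2 ≤ ν) :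
    ∃! Sg₀ : Matrix (Fin n) (Fin n) ℝ,
      Sg₀.PosDef ∧
      (1 - B * (Bᵀ * B)⁻¹ * Bᵀ) * (Sg₀ - A * Sg₀ * Aᵀ) * (1 - B * (Bᵀ * B)⁻¹ * Bᵀ) = 0 ∧
      ∀ Sg2 : Matrix (Fin n) (Fin n) ℝ, Sg2.PosDef →
        (1 - B * (Bᵀ * B)⁻¹ * Bᵀ) * (Sg2 - A * Sg2 * Aᵀ) * (1 - B * (Bᵀ * B)⁻¹ * Bᵀ) = 0 →
          DtauR (1 - (ν : ℝ)⁻¹) Sg₀ SgC L ≤ DtauR (1 - (ν : ℝ)⁻¹) Sg2 SgC L := by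
  set P := 1 - B * (Bᵀ * B)⁻¹ * Bᵀ with hP
  have hν' : (0 : ℝ) < (ν : ℝ)⁻¹ := inv_pos.2 (by exact_mod_cast (by omega : 0 < ν))
  have hτ1 : 1 - (ν : ℝ)⁻¹ < 1 := by linarith
  have hτ0 : 0 < 1 - (ν : ℝ)⁻¹ :=
    sub_pos.2 (inv_lt_one_of_one_lt₀ (by exact_mod_cast (by omega : 1 < ν)))
  have hLunit : IsUnit L := by
    rw [isUnit_iff_isUnit_det]
    have h := (isUnit_iff_isUnit_det _).1 hSgC.isUnit
    rw [← hLSg, det_mul] at h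
    exact isUnit_of_mul_isUnit_left h
  have hdet : IsUnit L.det := (isUnit_iff_isUnit_det L).1 hLunit
  have hdet' : IsUnit Lᵀ.det := by rwa [det_transpose]
  have hPB : P * B = 0 := by
    have hpd : (Bᵀ * B).PosDef := PosDef.conjTranspose_mul_self B
      (mulVec_injective_of_rank_eq_card (hB.trans (Fintype.card_fin m).symm))
    rw [hP, Matrix.sub_mul, Matrix.one_mul, Matrix.mul_assoc _ Bᵀ B, Matrix.mul_assoc,
      nonsing_inv_mul _ ((isUnit_iff_isUnit_det _).1 hpd.isUnit), Matrix.mul_one, sub_self]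
  have hpos : ∀ Z : Matrix (Fin n) (Fin n) ℝ, (L * Z * Lᵀ).PosDef ↔ Z.PosDef := fun Z =>
    hLunit.posDef_star_right_conjugate_iff
  have hsurj : ∀ X : Matrix (Fin n) (Fin n) ℝ, L * (L⁻¹ * X * (Lᵀ)⁻¹) * Lᵀ = X := by
    intro X
    rw [Matrix.mul_assoc L⁻¹, mul_nonsing_inv_cancel_left _ _ hdet,
      nonsing_inv_mul_cancel_right _ _ hdet']
  have hD : ∀ X Y : Matrix (Fin n) (Fin n) ℝ,
      DtauR (1 - (ν : ℝ)⁻¹) (L * X * Lᵀ) SgC L ≤ DtauR (1 - (ν : ℝ)⁻¹) (L * Y * Lᵀ) SgC L ↔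
        traceSubRpow (1 - (ν : ℝ)⁻¹) X ≤ traceSubRpow (1 - (ν : ℝ)⁻¹) Y := by
    intro X Y
    rw [← hLSg, DtauR_conj hLunit, DtauR_conj hLunit, add_le_add_iff_right]
    exact mul_le_mul_iff_right₀ (one_div_pos.2 (sub_pos.2 hτ1))
  have hfeas : ∃ Z ∈ conjFeasibleSubmodule P A L, Z.PosDef := by
    obtain ⟨W, hW, hWeq⟩ := exists_posDef_sub_mul_mul_transpose_eq hA hreach
    refine ⟨L⁻¹ * W * (Lᵀ)⁻¹, ?_, (hpos _).1 (by rwa [hsurj])⟩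
    change P * (L * (L⁻¹ * W * (Lᵀ)⁻¹) * Lᵀ - A * (L * (L⁻¹ * W * (Lᵀ)⁻¹) * Lᵀ) * Aᵀ) * P = 0
    rw [hsurj, hWeq, ← Matrix.mul_assoc, hPB, Matrix.zero_mul, Matrix.zero_mul]
  obtain ⟨Z, ⟨hZS, hZ, hZmin⟩, huniq⟩ := existsUnique_isMinOn_traceSubRpow hτ0 hτ1 hfeas
  refine ⟨L * Z * Lᵀ, ⟨(hpos Z).2 hZ, hZS, fun X hX hXfeas => ?_⟩, ?_⟩
  · rw [← hsurj X] at hX hXfeas ⊢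
    exact (hD _ _).2 (hZmin _ hXfeas ((hpos _).1 hX))
  · rintro X ⟨hX, hXfeas, hXmin⟩
    rw [← hsurj X] at hX hXfeas hXmin ⊢
    rw [huniq _ ⟨hXfeas, (hpos _).1 hX,
      fun Y hYS hY => (hD _ _).1 (hXmin _ ((hpos Y).2 hY) hYS)⟩]
end
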